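/- Fix q ∈ (2,∞] and let H ⊆ ℝⁿ be any hyperplane through the origin. Then w(Proj_{H₁} B_q^n) ≤ w(Proj_H B_q^n) ≤ w(Proj_{Hₙ} B_q^n), where H₁ = (1,0,…,0)^⊥ and Hₙ = (1,1,…,1)^⊥. -/

import Mathlib

open MeasureTheory
open scoped MeasureTheory RealInnerProductSpace ENNReal

/-- The unit ball of `ℓ_q^n` (with `q = ∞` allowed) inside Euclidean space. -/
def lqBall (n : ℕ) (q : ℝ≥0∞) : Set (EuclideanSpace ℝ (Fin n)) :=
  {x | if q = ∞ then ∀ i, |x i| ≤ 1 else ∑ i, |x i| ^ q.toReal ≤ 1}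

/-- The mean width, computed inside the hyperplane `θ^⊥`, of the orthogonal projection of a
body `B ⊆ ℝⁿ` onto `θ^⊥`: the average over the unit sphere of `θ^⊥` (with its rotationally
invariant probability measure, i.e. normalized `(n-2)`-dimensional Hausdorff measure) of the
support function of `Proj_{θ^⊥} B`. -/
noncomputable def meanWidthProj (n : ℕ) (B : Set (EuclideanSpace ℝ (Fin n)))
    (θ : EuclideanSpace ℝ (Fin n)) : ℝ :=
  (∫ u in {u : EuclideanSpace ℝ (Fin n) | ‖u‖ = 1 ∧ ⟪u, θ⟫ = 0},
      sSup ((fun x => ⟪x, u⟫) '' ((fun x => x - ⟪x, θ⟫ • θ) '' B)) ∂μH[(n : ℝ) - 2]) /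
    (μH[(n : ℝ) - 2] {u : EuclideanSpace ℝ (Fin n) | ‖u‖ = 1 ∧ ⟪u, θ⟫ = 0}).toReal

open Filter Topology

/-- Functions generated from the Gaussians `u ↦ exp (-∑ i, t i * u i ^ 2)`, `t ≥ 0`, by nonnegative
linear combinations and bounded pointwise sequential limits. -/
inductive IsGaussianMixture {ι : Type*} [Fintype ι] : (EuclideanSpace ℝ ι → ℝ) → Prop
  | gaussian (t : ι → ℝ) (ht : ∀ i, 0 ≤ t i) :
      IsGaussianMixture fun u => Real.exp (-∑ i, t i * u i ^ 2)
  | add {f g : EuclideanSpace ℝ ι → ℝ} : IsGaussianMixture f → IsGaussianMixture g →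
      IsGaussianMixture fun u => f u + g u
  | smul {f : EuclideanSpace ℝ ι → ℝ} (c : ℝ) (hc : 0 ≤ c) : IsGaussianMixture f →
      IsGaussianMixture fun u => c * f u
  | lim {f : EuclideanSpace ℝ ι → ℝ} (F : ℕ → EuclideanSpace ℝ ι → ℝ) (C : ℝ)
      (hF : ∀ k, IsGaussianMixture (F k)) (hC : ∀ k u, F k u ≤ C)
      (hlim : ∀ u, Tendsto (fun k => F k u) atTop (𝓝 (f u))) : IsGaussianMixture f

/-- The functions whose exponentials `exp (-s f)`, `s ≥ 0`, are all Gaussian mixtures. -/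
def IsGaussianExponent {ι : Type*} [Fintype ι] (f : EuclideanSpace ℝ ι → ℝ) : Prop :=
  ∀ s : ℝ, 0 ≤ s → IsGaussianMixture fun u => Real.exp (-(s * f u))

namespace IsGaussianMixture

variable {ι : Type*} [Fintype ι] {f g : EuclideanSpace ℝ ι → ℝ}

theorem nonneg (hf : IsGaussianMixture f) (u : EuclideanSpace ℝ ι) : 0 ≤ f u := by
  induction hf with
  | gaussian t ht => positivity
  | add _ _ h₁ h₂ => positivity
  | smul c hc _ h => positivity
  | lim F C _ _ hlim h => exact ge_of_tendsto' (hlim u) h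

theorem exists_le (hf : IsGaussianMixture f) : ∃ C : ℝ, 0 ≤ C ∧ ∀ u, f u ≤ C := by
  induction hf with
  | gaussian t ht =>
    refine ⟨1, zero_le_one, fun u => ?_⟩
    rw [Real.exp_le_one_iff, neg_nonpos]
    exact Finset.sum_nonneg fun i _ => mul_nonneg (ht i) (sq_nonneg _)
  | add _ _ h₁ h₂ =>
    obtain ⟨C, hC, h⟩ := h₁
    obtain ⟨D, hD, h'⟩ := h₂
    exact ⟨C + D, by positivity, fun u => add_le_add (h u) (h' u)⟩
  | smul c hc _ h =>
    obtain ⟨C, hC, h⟩ := h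
    exact ⟨c * C, by positivity, fun u => mul_le_mul_of_nonneg_left (h u) hc⟩
  | lim F C hF hC hlim _ =>
    exact ⟨C, ((hF 0).nonneg 0).trans (hC 0 0), fun u => le_of_tendsto' (hlim u) (hC · u)⟩

theorem measurable (hf : IsGaussianMixture f) : Measurable f := by
  induction hf with
  | gaussian t ht => fun_prop
  | add _ _ h₁ h₂ => exact h₁.add h₂
  | smul c hc _ h => exact h.const_mul c
  | lim F C _ _ hlim h => exact measurable_of_tendsto_metrizable h (tendsto_pi_nhds.2 hlim)

theorem gaussian_mul (t : ι → ℝ) (ht : ∀ i, 0 ≤ t i) (hf : IsGaussianMixture f) :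
    IsGaussianMixture fun u => Real.exp (-∑ i, t i * u i ^ 2) * f u := by
  induction hf with
  | gaussian r hr =>
    convert gaussian (fun i => t i + r i) (fun i => add_nonneg (ht i) (hr i)) using 2 with u
    rw [← Real.exp_add, ← neg_add, ← Finset.sum_add_distrib]
    simp only [add_mul]
  | add _ _ h₁ h₂ => simpa only [mul_add] using h₁.add h₂
  | smul c hc _ h => simpa only [mul_left_comm] using h.smul c hc
  | lim F C hF hC hlim h =>
    refine lim _ C h (fun k u => ?_) fun u => (hlim u).const_mul _
    refine (mul_le_of_le_one_left ((hF k).nonneg u) ?_).trans (hC k u)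
    rw [Real.exp_le_one_iff, neg_nonpos]
    exact Finset.sum_nonneg fun i _ => mul_nonneg (ht i) (sq_nonneg _)

theorem mul (hf : IsGaussianMixture f) (hg : IsGaussianMixture g) :
    IsGaussianMixture fun u => f u * g u := by
  induction hf with
  | gaussian t ht => exact gaussian_mul t ht hg
  | add _ _ h₁ h₂ => simpa only [add_mul] using h₁.add h₂
  | smul c hc _ h => simpa only [mul_assoc] using h.smul c hc
  | lim F C hF hC hlim h =>
    obtain ⟨D, hD, hgD⟩ := hg.exists_le
    refine lim _ (C * D) h (fun k u => ?_) fun u => (hlim u).mul_const _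
    exact mul_le_mul (hC k u) (hgD u) (hg.nonneg u) (((hF k).nonneg u).trans (hC k u))

theorem const (c : ℝ) (hc : 0 ≤ c) : IsGaussianMixture fun _ : EuclideanSpace ℝ ι => c := by
  simpa using (gaussian (ι := ι) (fun _ => 0) fun _ => le_rfl).smul c hc

theorem pow (hf : IsGaussianMixture f) (k : ℕ) : IsGaussianMixture fun u => f u ^ k := by
  induction k with
  | zero => simpa using const (ι := ι) 1 zero_le_one
  | succ k ih => simpa only [pow_succ] using ih.mul hf

theorem sum {κ : Type*} (s : Finset κ) (F : κ → EuclideanSpace ℝ ι → ℝ)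
    (hF : ∀ k, IsGaussianMixture (F k)) : IsGaussianMixture fun u => ∑ k ∈ s, F k u := by
  classical
  induction s using Finset.induction_on with
  | empty => simpa using const (ι := ι) 0 le_rfl
  | insert a s ha ih => simpa only [Finset.sum_insert ha] using (hF a).add ih

/-- A power series with nonnegative coefficients acts on Gaussian mixtures. -/
theorem hasSum {c : ℕ → ℝ} (hc : ∀ k, 0 ≤ c k) {φ : ℝ → ℝ} {C : ℝ} (hf : IsGaussianMixture f)
    (hφ : ∀ u, HasSum (fun k => c k * f u ^ k) (φ (f u))) (hC : ∀ u, φ (f u) ≤ C) :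
    IsGaussianMixture fun u => φ (f u) :=
  lim (fun K u => ∑ k ∈ Finset.range K, c k * f u ^ k) C
    (fun _ => sum _ _ fun k => (hf.pow k).smul _ (hc k))
    (fun _ u => (sum_le_hasSum _ (fun k _ => mul_nonneg (hc k) (pow_nonneg (hf.nonneg u) k))
      (hφ u)).trans (hC u))
    fun u => (hφ u).tendsto_sum_nat

theorem exp (hf : IsGaussianMixture f) : IsGaussianMixture fun u => Real.exp (f u) := by
  obtain ⟨C, _, hC⟩ := hf.exists_le
  refine hf.hasSum (c := fun k => (k.factorial : ℝ)⁻¹) (φ := Real.exp) (C := Real.exp C)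
    (fun k => by positivity) (fun u => ?_) fun u => Real.exp_le_exp.2 (hC u)
  have := NormedSpace.expSeries_div_hasSum_exp (f u)
  rw [← Real.exp_eq_exp_ℝ] at this
  simpa only [div_eq_inv_mul] using this

end IsGaussianMixture

theorem descPochhammer_smeval_eq_prod_range (α : ℝ) (k : ℕ) :
    (descPochhammer ℤ k).smeval α = ∏ i ∈ Finset.range k, (α - i) := by
  induction k with
  | zero => simp
  | succ k ih =>
    rw [descPochhammer_succ_right, Polynomial.smeval_mul, ih, Finset.prod_range_succ]
    simp [Polynomial.smeval_sub, Polynomial.smeval_natCast]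

theorem neg_one_pow_mul_choose_nonpos {α : ℝ} (h₀ : 0 ≤ α) (h₁ : α ≤ 1) (k : ℕ) :
    (-1) ^ (k + 1) * Ring.choose α (k + 1) ≤ 0 := by
  have h : ((k + 1).factorial : ℝ) * ((-1) ^ (k + 1) * Ring.choose α (k + 1))
      = ∏ i ∈ Finset.range (k + 1), ((i : ℝ) - α) := by
    have h := Ring.descPochhammer_eq_factorial_smul_choose α (k + 1)
    rw [nsmul_eq_mul, descPochhammer_smeval_eq_prod_range] at h
    rw [mul_left_comm, ← h]
    conv_lhs => rw [← Finset.card_range (k + 1), ← Finset.prod_const, Finset.card_range]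
    rw [← Finset.prod_mul_distrib]
    simp
  refine nonpos_of_mul_nonpos_right (a := ((k + 1).factorial : ℝ)) ?_ (by positivity)
  rw [h, Finset.prod_range_succ']
  refine mul_nonpos_of_nonneg_of_nonpos (Finset.prod_nonneg fun i _ => ?_) (by simpa using h₀)
  push_cast
  linarith [Nat.cast_nonneg (α := ℝ) i]

theorem hasSum_one_sub_one_sub_rpow {α x : ℝ} (h₀ : 0 ≤ x) (h₁ : x < 1) :
    HasSum (fun k : ℕ => (if k = 0 then 0 else -((-1) ^ k * Ring.choose α k)) * x ^ k)
      (1 - (1 - x) ^ α) := by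
  have h := (Real.one_add_rpow_hasFPowerSeriesOnBall_zero (a := α)).hasSum (y := -x) (by
    simpa [Real.enorm_eq_ofReal_abs, abs_of_nonneg h₀] using h₁)
  have h2 := (hasSum_ite_eq (0 : ℕ) (1 : ℝ)).sub h
  rw [zero_add, ← sub_eq_add_neg] at h2
  refine (congrArg (HasSum · _) (funext fun k => ?_)).mpr h2
  rw [binomialSeries_apply]
  rcases eq_or_ne k 0 with rfl | hk
  · simp
  · simp [hk, neg_pow x k]
    ring

theorem tendsto_mul_one_sub_exp_neg_div (y : ℝ) (hy : 0 ≤ y) :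
    Tendsto (fun k : ℕ => ((k : ℝ) + 1) * (1 - Real.exp (-((y + 1 / ((k : ℝ) + 1)) / (k + 1)))))
      atTop (𝓝 y) := by
  have h0 := tendsto_one_div_add_atTop_nhds_zero_nat (𝕜 := ℝ)
  have h1 : Tendsto (fun k : ℕ => y + 1 / ((k : ℝ) + 1)) atTop (𝓝 y) := by
    simpa using h0.const_add y
  have h2 : Tendsto (fun k : ℕ => (y + 1 / ((k : ℝ) + 1)) / (k + 1)) atTop (𝓝 0) := by
    simpa [div_eq_mul_inv] using h1.mul h0
  have h3 : Tendsto (fun k : ℕ => (y + 1 / ((k : ℝ) + 1)) / (1 + (y + 1 / ((k : ℝ) + 1)) / (k + 1)))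
      atTop (𝓝 y) := by
    simpa [Pi.div_def] using h1.div (h2.const_add 1) (by simp)
  refine tendsto_of_tendsto_of_tendsto_of_le_of_le h3 h1 (fun k => ?_) fun k => ?_
  · set z := (y + 1 / ((k : ℝ) + 1)) / (k + 1) with hz
    have hz0 : 0 ≤ z := by positivity
    have e : y + 1 / ((k : ℝ) + 1) = (k + 1) * z := by rw [hz]; field_simp
    have e2 : Real.exp (-z) ≤ (1 + z)⁻¹ := by
      rw [Real.exp_neg]
      exact inv_anti₀ (by positivity) (by linarith [Real.add_one_le_exp z])
    beta_reduce
    rw [e, mul_div_assoc]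
    refine mul_le_mul_of_nonneg_left ?_ (by positivity)
    have : z / (1 + z) = 1 - (1 + z)⁻¹ := by field_simp; ring
    linarith
  · set z := (y + 1 / ((k : ℝ) + 1)) / (k + 1) with hz
    have e : y + 1 / ((k : ℝ) + 1) = (k + 1) * z := by rw [hz]; field_simp
    beta_reduce
    rw [e]
    refine mul_le_mul_of_nonneg_left ?_ (by positivity)
    linarith [Real.add_one_le_exp (-z)]

namespace IsGaussianExponent

variable {ι : Type*} [Fintype ι] {f g : EuclideanSpace ℝ ι → ℝ}

theorem sq (i : ι) : IsGaussianExponent fun u : EuclideanSpace ℝ ι => u i ^ 2 := by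
  classical
  intro s hs
  convert IsGaussianMixture.gaussian (fun j => if j = i then s else 0)
    (fun j => by split_ifs <;> simp [hs]) using 4 with u
  simp

theorem sum (F : ι → EuclideanSpace ℝ ι → ℝ) (hF : ∀ i, IsGaussianExponent (F i)) :
    IsGaussianExponent fun u => ∑ i, F i u := by
  classical
  intro s hs
  suffices h : ∀ t : Finset ι, IsGaussianMixture fun u => Real.exp (-(s * ∑ i ∈ t, F i u)) from h _
  intro t
  induction t using Finset.induction_on with
  | empty => simpa using IsGaussianMixture.const (ι := ι) 1 zero_le_one
  | insert a t ha ih =>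
    convert (hF a s hs).mul ih using 2 with u
    rw [Finset.sum_insert ha, ← Real.exp_add]
    ring_nf

theorem rpow (hf : IsGaussianExponent f) (h0 : ∀ u, 0 ≤ f u) {α : ℝ} (hα₀ : 0 ≤ α) (hα₁ : α ≤ 1) :
    IsGaussianExponent fun u => f u ^ α := by
  intro s hs
  set x : ℕ → EuclideanSpace ℝ ι → ℝ :=
    fun k u => Real.exp (-((f u + 1 / ((k : ℝ) + 1)) / (k + 1))) with hx
  have hx1 (k u) : x k u < 1 := by
    have := h0 u
    simp only [hx, Real.exp_lt_one_iff, Left.neg_neg_iff]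
    positivity
  have hx0 (k u) : 0 ≤ x k u := (Real.exp_pos _).le
  have hxm (k) : IsGaussianMixture (x k) := by
    convert (hf (1 / ((k : ℝ) + 1)) (by positivity)).smul
      (Real.exp (-(1 / ((k : ℝ) + 1)) / (k + 1))) (by positivity) using 2 with u
    rw [← Real.exp_add]
    simp only [hx]
    congr 1
    ring
  have hφ (k) : IsGaussianMixture fun u => 1 - (1 - x k u) ^ α := by
    refine (hxm k).hasSum (φ := fun y => 1 - (1 - y) ^ α) (C := 1) (fun j => ?_)
      (fun u => hasSum_one_sub_one_sub_rpow (hx0 k u) (hx1 k u)) fun u => ?_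
    · rcases j with _ | j
      · simp
      · simpa using neg_one_pow_mul_choose_nonpos hα₀ hα₁ j
    · simpa using Real.rpow_nonneg (by linarith [hx1 k u]) α
  refine IsGaussianMixture.lim
    (fun k u => Real.exp (-(s * (((k : ℝ) + 1) * (1 - x k u)) ^ α))) 1 (fun k => ?_)
    (fun k u => ?_) fun u => ?_
  · convert (((hφ k).smul (s * ((k : ℝ) + 1) ^ α) (by positivity)).exp).smul
      (Real.exp (-(s * ((k : ℝ) + 1) ^ α))) (by positivity) using 2 with u
    rw [← Real.exp_add, Real.mul_rpow (by positivity) (by linarith [hx1 k u])]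
    congr 1
    ring
  · have := hx1 k u
    rw [Real.exp_le_one_iff, neg_nonpos]
    exact mul_nonneg hs (Real.rpow_nonneg (mul_nonneg (by positivity) (by linarith)) _)
  · have h := (tendsto_mul_one_sub_exp_neg_div (f u) (h0 u)).rpow_const (p := α) (Or.inr hα₀)
    exact (Real.continuous_exp.tendsto _).comp (h.const_mul s).neg

theorem lpNorm {p : ℝ} (h₁ : 1 ≤ p) (h₂ : p ≤ 2) :
    IsGaussianExponent fun u : EuclideanSpace ℝ ι => (∑ i, |u i| ^ p) ^ (1 / p) := by
  refine rpow (sum (fun i u => |u i| ^ p) fun i => ?_)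
    (fun u => Finset.sum_nonneg fun i _ => by positivity) (by positivity)
    ((div_le_one (by positivity)).2 h₁)
  convert (sq i).rpow (fun u => sq_nonneg _) (α := p / 2) (by positivity) (by linarith)
    using 2 with u
  rw [← sq_abs, ← Real.rpow_natCast, ← Real.rpow_mul (abs_nonneg _)]
  congr 1
  push_cast
  ring

end IsGaussianExponent

section HyperplaneGaussian

variable {ι : Type*} [Fintype ι] {E : Type*} [NormedAddCommGroup E] [InnerProductSpace ℝ E]
  [FiniteDimensional ℝ E]

theorem exists_hyperplane_coordinates (L : E →ₗᵢ[ℝ] EuclideanSpace ℝ ι) {a : EuclideanSpace ℝ ι}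
    (ha : ‖a‖ = 1) (hL : ∀ x, ⟪L x, a⟫ = 0) (hE : Module.finrank ℝ E + 1 = Fintype.card ι) :
    ∃ Φ : WithLp 2 (E × ℝ) ≃ₗᵢ[ℝ] EuclideanSpace ℝ ι, ∀ z, Φ z = L z.fst + z.snd • a := by
  let f : WithLp 2 (E × ℝ) →ₗᵢ[ℝ] EuclideanSpace ℝ ι :=
    { toFun z := L z.fst + z.snd • a
      map_add' z w := by simp only [WithLp.add_fst, WithLp.add_snd, map_add, add_smul]; abel
      map_smul' c z := by simp [smul_smul]
      norm_map' z := by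
        rw [← sq_eq_sq₀ (norm_nonneg _) (norm_nonneg _), WithLp.prod_norm_sq_eq_of_L2]
        simp [norm_add_sq_real, inner_smul_right, hL, norm_smul, ha] }
  have hdim : Module.finrank ℝ (WithLp 2 (E × ℝ)) = Module.finrank ℝ (EuclideanSpace ℝ ι) := by
    rw [(WithLp.linearEquiv 2 ℝ (E × ℝ)).finrank_eq]
    simpa using hE
  exact ⟨f.toLinearIsometryEquiv hdim, fun z => rfl⟩

theorem integrable_exp_neg_sum_mul_sq {c : ι → ℝ} (hc : ∀ i, 0 < c i) :
    Integrable fun y : EuclideanSpace ℝ ι => Real.exp (-∑ i, c i * y i ^ 2) := by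
  rw [← (PiLp.volume_preserving_toLp ι).integrable_comp_emb
    (MeasurableEquiv.toLp 2 _).measurableEmbedding]
  convert Integrable.fintype_prod (f := fun i (y : ℝ) => Real.exp (-c i * y ^ 2))
    (fun i => integrable_exp_neg_mul_sq (hc i)) using 2 with y
  · simp [← Real.exp_sum, Finset.sum_neg_distrib]
  · exact volume_pi

theorem integral_exp_neg_sum_mul_sq (c : ι → ℝ) :
    ∫ y : EuclideanSpace ℝ ι, Real.exp (-∑ i, c i * y i ^ 2) = ∏ i, √(Real.pi / c i) := by
  rw [← (PiLp.volume_preserving_toLp ι).integral_comp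
    (MeasurableEquiv.toLp 2 _).measurableEmbedding]
  simp_rw [← integral_gaussian, ← integral_fintype_prod_volume_eq_prod]
  simp [← Real.exp_sum, Finset.sum_neg_distrib]

variable [MeasurableSpace E] [BorelSpace E]

/-- The Gaussian integral of a diagonal quadratic form over the hyperplane `a^⊥`. -/
theorem integral_exp_neg_sum_mul_sq_hyperplane (L : E →ₗᵢ[ℝ] EuclideanSpace ℝ ι)
    {a : EuclideanSpace ℝ ι} (ha : ‖a‖ = 1) (hL : ∀ x, ⟪L x, a⟫ = 0)
    (hE : Module.finrank ℝ E + 1 = Fintype.card ι) {c : ι → ℝ} (hc : ∀ i, 0 < c i) :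
    (∫ x : E, Real.exp (-∑ i, c i * L x i ^ 2)) * √(Real.pi * ∑ i, a i ^ 2 / c i)
      = ∏ i, √(Real.pi / c i) := by
  obtain ⟨Φ, hΦ⟩ := exists_hyperplane_coordinates L ha hL hE
  have hsq : ∑ i, a i ^ 2 = 1 := by
    rw [← EuclideanSpace.real_norm_sq_eq, ha, one_pow]
  set h := ∑ i, a i ^ 2 / c i with hh
  have hpos : 0 < h := by
    refine lt_of_le_of_ne (Finset.sum_nonneg fun i _ => div_nonneg (sq_nonneg _) (hc i).le) ?_
    intro h0
    have := (Finset.sum_eq_zero_iff_of_nonneg fun i _ =>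
      div_nonneg (sq_nonneg _) (hc i).le).1 h0.symm
    have h1 : ∑ i, a i ^ 2 = 0 := Finset.sum_eq_zero fun i hi => by
      simpa [(hc i).ne'] using this i hi
    linarith
  let v : EuclideanSpace ℝ ι := WithLp.toLp 2 fun i => a i / c i
  have hv : ⟪v, a⟫ = h := by
    simp [PiLp.inner_apply, v, hh]
    exact Finset.sum_congr rfl fun i _ => by ring
  obtain ⟨w, hw⟩ : ∃ w : E, L w = a - h⁻¹ • v := by
    obtain ⟨z, hz⟩ := Φ.surjective (a - h⁻¹ • v)
    have hs : z.snd = 0 := by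
      have := congrArg (⟪·, a⟫) hz
      simpa [hΦ, inner_add_left, inner_sub_left, inner_smul_left, hL, ha, hv, hpos.ne'] using this
    exact ⟨z.fst, by simpa [hΦ, hs] using hz⟩
  have hcross (x : E) : ∑ i, c i * (L x i * v i) = 0 := by
    rw [← hL x]
    simp only [PiLp.inner_apply, v]
    refine Finset.sum_congr rfl fun i _ => ?_
    have := (hc i).ne'
    simp
    field_simp
  have hvv : ∑ i, c i * v i ^ 2 = h := by
    refine Finset.sum_congr rfl fun i _ => ?_
    have := (hc i).ne'
    simp only [v]
    field_simp
  have hquad (x : E) (s : ℝ) : ∑ i, c i * (L x + s • a) i ^ 2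
      = ∑ i, c i * L (x + s • w) i ^ 2 + h⁻¹ * s ^ 2 := by
    have e : L x + s • a = L (x + s • w) + (s * h⁻¹) • v := by
      rw [map_add, map_smul, hw, smul_sub, mul_smul]
      abel
    rw [e]
    calc _ = ∑ i, c i * L (x + s • w) i ^ 2
          + 2 * (s * h⁻¹) * ∑ i, c i * (L (x + s • w) i * v i)
          + (s * h⁻¹) ^ 2 * ∑ i, c i * v i ^ 2 := by
            rw [Finset.mul_sum, Finset.mul_sum, ← Finset.sum_add_distrib,
              ← Finset.sum_add_distrib]
            refine Finset.sum_congr rfl fun i _ => ?_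
            simp only [PiLp.add_apply, PiLp.smul_apply, smul_eq_mul]
            ring
      _ = _ := by rw [hcross, hvv]; field_simp; ring
  have hmp : MeasurePreserving (fun z : E × ℝ => L z.1 + z.2 • a) := by
    have := Φ.measurePreserving.comp (WithLp.volume_preserving_toLp E ℝ)
    convert this using 2 with z
    simp [hΦ]
  have hemb : MeasurableEmbedding (fun z : E × ℝ => L z.1 + z.2 • a) := by
    have := Φ.toHomeomorph.measurableEmbedding.comp
      (MeasurableEquiv.toLp 2 (E × ℝ)).measurableEmbedding
    convert this using 2 with z
    simp [hΦ]
  have hint := (hmp.integrable_comp_emb hemb).2 (integrable_exp_neg_sum_mul_sq hc)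
  rw [← integral_exp_neg_sum_mul_sq c, ← hmp.integral_comp hemb]
  rw [Measure.volume_eq_prod] at hint ⊢
  rw [Function.comp_def] at hint
  rw [integral_prod_symm _ hint]
  simp only [hquad, neg_add, Real.exp_add, integral_mul_const]
  simp_rw [integral_add_right_eq_self (fun x : E => Real.exp (-∑ i, c i * L x i ^ 2)),
    integral_const_mul, ← neg_mul, integral_gaussian, div_inv_eq_mul]

end HyperplaneGaussian

section GaussianWeight

variable (E : Type*) [NormedAddCommGroup E] [InnerProductSpace ℝ E]
  [FiniteDimensional ℝ E] [MeasurableSpace E] [BorelSpace E]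

/-- The unnormalized standard Gaussian measure, with density `exp (-‖x‖ ^ 2 / 2)`. -/
noncomputable def gaussianWeight : Measure E :=
  volume.withDensity fun x => ENNReal.ofReal (Real.exp (-(2⁻¹ * ‖x‖ ^ 2)))

variable {E}

theorem integral_gaussianWeight (f : E → ℝ) :
    ∫ x, f x ∂gaussianWeight E = ∫ x, Real.exp (-(2⁻¹ * ‖x‖ ^ 2)) * f x := by
  rw [gaussianWeight, integral_withDensity_eq_integral_toReal_smul (by fun_prop) (by simp)]
  simp [Real.exp_nonneg]

theorem integrable_exp_neg_mul_norm_sq {b : ℝ} (hb : 0 < b) :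
    Integrable fun x : E => Real.exp (-(b * ‖x‖ ^ 2)) := by
  have h := (GaussianFourier.integrable_cexp_neg_mul_sq_norm_add (V := E) (b := b)
    (by simpa using hb) 0 0).norm
  refine h.congr (.of_forall fun x => ?_)
  simp [Complex.norm_exp, ← Complex.ofReal_pow]

instance : IsFiniteMeasure (gaussianWeight E) :=
  isFiniteMeasure_withDensity_ofReal
    (integrable_exp_neg_mul_norm_sq (E := E) (b := 2⁻¹) (by norm_num)).2

theorem integrable_norm_gaussianWeight : Integrable (fun x => ‖x‖) (gaussianWeight E) := by
  rw [gaussianWeight, integrable_withDensity_iff_integrable_smul' (by fun_prop) (by simp)]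
  refine (integrable_exp_neg_mul_norm_sq (E := E) (b := 4⁻¹) (by norm_num)).mono'
    (by fun_prop) (.of_forall fun x => ?_)
  have h : ‖x‖ ≤ Real.exp (4⁻¹ * ‖x‖ ^ 2) := by
    nlinarith [Real.add_one_le_exp (4⁻¹ * ‖x‖ ^ 2), sq_nonneg (‖x‖ - 2)]
  simp only [ENNReal.toReal_ofReal (Real.exp_nonneg _), smul_eq_mul, norm_mul, abs_norm,
    Real.norm_eq_abs, Real.abs_exp]
  calc _ ≤ Real.exp (-(2⁻¹ * ‖x‖ ^ 2)) * Real.exp (4⁻¹ * ‖x‖ ^ 2) := by gcongr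
    _ = _ := by rw [← Real.exp_add]; congr 1; ring

theorem measurePreserving_gaussianWeight (R : E ≃ₗᵢ[ℝ] E) :
    MeasurePreserving R (gaussianWeight E) (gaussianWeight E) := by
  refine ⟨R.continuous.measurable, ?_⟩
  ext s hs
  rw [Measure.map_apply R.continuous.measurable hs, gaussianWeight,
    withDensity_apply _ (R.continuous.measurable hs), withDensity_apply _ hs,
    ← R.measurePreserving.setLIntegral_comp_preimage hs (by fun_prop)]
  simp

variable {ι κ : Type*} [Fintype ι] [Fintype κ]

theorem inv_le_sum_mul_inv {w s : κ → ℝ} (hw : ∀ k, 0 ≤ w k) (hw₁ : ∑ k, w k = 1)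
    (hs : ∀ k, 0 < s k) {r : ℝ} (hr : 0 < r) (h : r ^ 2 = ∑ k, w k * s k ^ 2) :
    r⁻¹ ≤ ∑ k, w k * (s k)⁻¹ := by
  have key (k) : r⁻¹ * (3 / 2 - s k ^ 2 / (2 * r ^ 2)) ≤ (s k)⁻¹ := by
    have := hs k
    rw [← sub_nonneg]
    have e : (s k)⁻¹ - r⁻¹ * (3 / 2 - s k ^ 2 / (2 * r ^ 2))
        = (s k - r) ^ 2 * (s k + 2 * r) / (2 * r ^ 3 * s k) := by
      field_simp
      ring
    rw [e]
    positivity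
  calc r⁻¹ = ∑ k, w k * (r⁻¹ * (3 / 2 - s k ^ 2 / (2 * r ^ 2))) := by
        have e : ∑ k, w k * (r⁻¹ * (3 / 2 - s k ^ 2 / (2 * r ^ 2)))
            = r⁻¹ * (3 / 2) * ∑ k, w k - r⁻¹ / (2 * r ^ 2) * ∑ k, w k * s k ^ 2 := by
          rw [Finset.mul_sum, Finset.mul_sum, ← Finset.sum_sub_distrib]
          exact Finset.sum_congr rfl fun k _ => by ring
        rw [e, hw₁, ← h]
        field_simp
        norm_num
    _ ≤ _ := Finset.sum_le_sum fun k _ => mul_le_mul_of_nonneg_left (key k) (hw k)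

section Comparison

variable (hE : Module.finrank ℝ E + 1 = Fintype.card ι)
  {L : E →ₗᵢ[ℝ] EuclideanSpace ℝ ι} {a : EuclideanSpace ℝ ι} (ha : ‖a‖ = 1)
  (hL : ∀ x, ⟪L x, a⟫ = 0) {M : κ → E →ₗᵢ[ℝ] EuclideanSpace ℝ ι} {b : κ → EuclideanSpace ℝ ι}
  (hb : ∀ k, ‖b k‖ = 1) (hM : ∀ k x, ⟪M k x, b k⟫ = 0) {w : κ → ℝ} (hw : ∀ k, 0 ≤ w k)
  (hw₁ : ∑ k, w k = 1) (hab : ∀ i, a i ^ 2 = ∑ k, w k * b k i ^ 2)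

include hE ha hL hb hM hw hw₁ hab

theorem integral_gaussian_comp_le {t : ι → ℝ} (ht : ∀ i, 0 ≤ t i) :
    ∫ x, Real.exp (-∑ i, t i * L x i ^ 2) ∂gaussianWeight E
      ≤ ∑ k, w k * ∫ x, Real.exp (-∑ i, t i * M k x i ^ 2) ∂gaussianWeight E := by
  set c : ι → ℝ := fun i => 2⁻¹ + t i
  have hc (i) : 0 < c i := by have := ht i; positivity
  have key {N : E →ₗᵢ[ℝ] EuclideanSpace ℝ ι} {v : EuclideanSpace ℝ ι} (hv : ‖v‖ = 1)
      (hN : ∀ x, ⟪N x, v⟫ = 0) : 0 < √(Real.pi * ∑ i, v i ^ 2 / c i) ∧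
        ∫ x, Real.exp (-∑ i, t i * N x i ^ 2) ∂gaussianWeight E
          = (∏ i, √(Real.pi / c i)) * (√(Real.pi * ∑ i, v i ^ 2 / c i))⁻¹ := by
    have h := integral_exp_neg_sum_mul_sq_hyperplane N hv hN hE hc
    have hP : 0 < ∏ i, √(Real.pi / c i) :=
      Finset.prod_pos fun i _ => Real.sqrt_pos.2 (div_pos Real.pi_pos (hc i))
    have hpos : 0 < √(Real.pi * ∑ i, v i ^ 2 / c i) := by
      refine lt_of_le_of_ne (Real.sqrt_nonneg _) fun h0 => ?_
      rw [← h0, mul_zero] at h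
      exact hP.ne h
    refine ⟨hpos, ?_⟩
    rw [← h, mul_inv_cancel_right₀ hpos.ne', integral_gaussianWeight]
    refine integral_congr_ae (.of_forall fun x => ?_)
    simp only [c, ← Real.exp_add, ← N.norm_map x, EuclideanSpace.real_norm_sq_eq, add_mul,
      Finset.sum_add_distrib, Finset.mul_sum, neg_add]
  rw [(key ha hL).2]
  simp_rw [fun k => (key (hb k) (hM k)).2, mul_left_comm (w _), ← Finset.mul_sum]
  refine mul_le_mul_of_nonneg_left ?_ (Finset.prod_nonneg fun i _ => Real.sqrt_nonneg _)
  refine inv_le_sum_mul_inv hw hw₁ (fun k => (key (hb k) (hM k)).1) (key ha hL).1 ?_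
  have hsq (v : EuclideanSpace ℝ ι) : √(Real.pi * ∑ i, v i ^ 2 / c i) ^ 2
      = Real.pi * ∑ i, v i ^ 2 / c i :=
    Real.sq_sqrt (mul_nonneg Real.pi_pos.le
      (Finset.sum_nonneg fun i _ => div_nonneg (sq_nonneg _) (hc i).le))
  simp_rw [hsq, hab, Finset.sum_div, Finset.mul_sum]
  rw [Finset.sum_comm]
  exact Finset.sum_congr rfl fun k _ => Finset.sum_congr rfl fun i _ => by ring

theorem IsGaussianMixture.integral_comp_le {f : EuclideanSpace ℝ ι → ℝ}
    (hf : IsGaussianMixture f) :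
    ∫ x, f (L x) ∂gaussianWeight E ≤ ∑ k, w k * ∫ x, f (M k x) ∂gaussianWeight E := by
  have hint {g : EuclideanSpace ℝ ι → ℝ} (hg : IsGaussianMixture g)
      (N : E →ₗᵢ[ℝ] EuclideanSpace ℝ ι) : Integrable (fun x => g (N x)) (gaussianWeight E) := by
    obtain ⟨C, _, hC⟩ := hg.exists_le
    refine Integrable.of_bound (hg.measurable.comp N.continuous.measurable).aestronglyMeasurable C
      (.of_forall fun x => ?_)
    rw [Real.norm_of_nonneg (hg.nonneg _)]
    exact hC _
  induction hf with
  | gaussian t ht => exact integral_gaussian_comp_le hE ha hL hb hM hw hw₁ hab ht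
  | add hf hg h₁ h₂ =>
    simp_rw [integral_add (hint hf _) (hint hg _), mul_add, Finset.sum_add_distrib]
    exact add_le_add h₁ h₂
  | smul c hc _ h =>
    simp_rw [integral_const_mul, mul_left_comm (w _), ← Finset.mul_sum]
    exact mul_le_mul_of_nonneg_left h hc
  | lim F C hF hC hlim h =>
    have ht (N : E →ₗᵢ[ℝ] EuclideanSpace ℝ ι) :=
      tendsto_integral_of_dominated_convergence (μ := gaussianWeight E)
        (F := fun k x => F k (N x)) (fun _ => C)
        (fun k => (hint (hF k) N).aestronglyMeasurable) (integrable_const C)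
        (fun k => .of_forall fun x => by
          rw [Real.norm_of_nonneg ((hF k).nonneg _)]
          exact hC k _)
        (.of_forall fun x => hlim (N x))
    exact le_of_tendsto_of_tendsto' (ht L)
      (tendsto_finsetSum _ fun k _ => (ht (M k)).const_mul (w k)) h

theorem IsGaussianExponent.sum_le_integral_comp {f : EuclideanSpace ℝ ι → ℝ}
    (hf : IsGaussianExponent f) (hf₀ : ∀ u, 0 ≤ f u) (hfm : Measurable f) {C : ℝ}
    (hfC : ∀ u, f u ≤ C * ‖u‖) :
    ∑ k, w k * ∫ x, f (M k x) ∂gaussianWeight E ≤ ∫ x, f (L x) ∂gaussianWeight E := by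
  set s : ℕ → ℝ := fun k => 1 / ((k : ℝ) + 1)
  have hs (k) : 0 < s k := by positivity
  have hs0 : Tendsto s atTop (𝓝[≠] 0) :=
    tendsto_nhdsWithin_iff.2 ⟨tendsto_one_div_add_atTop_nhds_zero_nat,
      .of_forall fun k => (hs k).ne'⟩
  have hlim (u) : Tendsto (fun k => (s k)⁻¹ * (1 - Real.exp (-(s k * f u)))) atTop (𝓝 (f u)) := by
    have h : HasDerivAt (fun r : ℝ => 1 - Real.exp (-(r * f u))) (f u) 0 :=
      ((((hasDerivAt_id' (0 : ℝ)).mul_const (f u)).fun_neg.exp).const_sub 1).congr_deriv (by simp)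
    simpa [Function.comp_def] using h.tendsto_slope_zero.comp hs0
  have hmeas (N : E →ₗᵢ[ℝ] EuclideanSpace ℝ ι) : Measurable fun x => f (N x) :=
    hfm.comp N.continuous.measurable
  have hexp (N : E →ₗᵢ[ℝ] EuclideanSpace ℝ ι) (k : ℕ) :
      Integrable (fun x => Real.exp (-(s k * f (N x)))) (gaussianWeight E) := by
    refine Integrable.of_bound (C := 1) ?_ (.of_forall fun x => ?_)
    · exact (((hmeas N).const_mul _).neg.exp).aestronglyMeasurable
    · rw [Real.norm_of_nonneg (Real.exp_nonneg _), Real.exp_le_one_iff, neg_nonpos]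
      exact mul_nonneg (hs k).le (hf₀ _)
  have ht (N : E →ₗᵢ[ℝ] EuclideanSpace ℝ ι) :=
    tendsto_integral_of_dominated_convergence (μ := gaussianWeight E)
      (F := fun k x => (s k)⁻¹ * (1 - Real.exp (-(s k * f (N x))))) (fun x => C * ‖x‖)
      (fun k => (((integrable_const 1).sub (hexp N k)).const_mul _).aestronglyMeasurable)
      (integrable_norm_gaussianWeight.const_mul C)
      (fun k => .of_forall fun x => by
        have h1 : Real.exp (-(s k * f (N x))) ≤ 1 := by
          rw [Real.exp_le_one_iff, neg_nonpos]
          exact mul_nonneg (hs k).le (hf₀ _)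
        have h2 := Real.add_one_le_exp (-(s k * f (N x)))
        rw [Real.norm_of_nonneg (mul_nonneg (inv_nonneg.2 (hs k).le) (by linarith)),
          inv_mul_le_iff₀ (hs k)]
        have h3 := hfC (N x)
        rw [N.norm_map] at h3
        nlinarith [mul_le_mul_of_nonneg_left h3 (hs k).le])
      (.of_forall fun x => hlim (N x))
  refine le_of_tendsto_of_tendsto'
    (tendsto_finsetSum Finset.univ fun k _ => (ht (M k)).const_mul (w k)) (ht L) fun k => ?_
  have h := (hf (s k) (hs k).le).integral_comp_le hE ha hL hb hM hw hw₁ hab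
  simp_rw [integral_const_mul, integral_sub (integrable_const 1) (hexp _ k),
    mul_left_comm (w _), ← Finset.mul_sum, mul_sub, Finset.sum_sub_distrib, ← Finset.sum_mul, hw₁,
    one_mul, ← mul_sub]
  refine mul_le_mul_of_nonneg_left ?_ (inv_nonneg.2 (hs k).le)
  linarith

end Comparison

end GaussianWeight

section InvariantMeasure

variable {E : Type*} [NormedAddCommGroup E] [InnerProductSpace ℝ E] [MeasurableSpace E]
  [BorelSpace E]

theorem charFun_eq_of_norm_eq {μ : Measure E}
    (hμ : ∀ R : E ≃ₗᵢ[ℝ] E, MeasurePreserving R μ μ) {ξ η : E} (h : ‖ξ‖ = ‖η‖) :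
    charFun μ ξ = charFun μ η := by
  have : CompleteSpace (Submodule.span ℝ {ξ - η}) := FiniteDimensional.complete ℝ _
  set R := (Submodule.span ℝ {ξ - η})ᗮ.reflection
  have hR : R ξ = η := Submodule.reflection_sub h
  rw [charFun_apply, charFun_apply,
    ← (hμ R).integral_comp (g := fun x => Complex.exp (⟪x, η⟫ * Complex.I))
      R.toHomeomorph.measurableEmbedding]
  refine integral_congr_ae (.of_forall fun x => ?_)
  have e : ⟪R x, η⟫ = ⟪x, ξ⟫ := by rw [← hR, R.inner_map_map]
  simp only [e]

theorem integral_charFun_smul {μ ν : Measure E} [IsFiniteMeasure ν]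
    (hμ : ∀ R : E ≃ₗᵢ[ℝ] E, MeasurePreserving R μ μ) (hν : ∀ᵐ v ∂ν, ‖v‖ = 1) (ξ : E) :
    ∫ v, charFun μ (‖ξ‖ • v) ∂ν = ν.real Set.univ * charFun μ ξ := by
  rw [integral_congr_ae (g := fun _ => charFun μ ξ), integral_const, Complex.real_smul]
  filter_upwards [hν] with v hv
  exact charFun_eq_of_norm_eq hμ (by simp [norm_smul, hv])

variable [FiniteDimensional ℝ E]

/-- Rotation invariant finite measures on the unit sphere are proportional. -/
theorem smul_eq_smul_of_measurePreserving {μ ν : Measure E} [IsFiniteMeasure μ]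
    [IsFiniteMeasure ν] (hμ : ∀ R : E ≃ₗᵢ[ℝ] E, MeasurePreserving R μ μ)
    (hν : ∀ R : E ≃ₗᵢ[ℝ] E, MeasurePreserving R ν ν) (hμ₁ : ∀ᵐ v ∂μ, ‖v‖ = 1)
    (hν₁ : ∀ᵐ v ∂ν, ‖v‖ = 1) :
    (ν Set.univ).toNNReal • μ = (μ Set.univ).toNNReal • ν := by
  refine Measure.ext_of_charFun (funext fun ξ => ?_)
  have h : ν.real Set.univ * charFun μ ξ = μ.real Set.univ * charFun ν ξ := by
    rw [← integral_charFun_smul hμ hν₁, ← integral_charFun_smul hν hμ₁]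
    simp_rw [charFun_apply]
    rw [integral_integral_swap]
    · simp [inner_smul_right, real_inner_comm]
    · refine Integrable.of_bound (C := 1) ?_ (.of_forall fun x => ?_)
      · exact Continuous.aestronglyMeasurable (by fun_prop)
      · simp [Function.uncurry, Complex.norm_exp]
  rw [charFun_apply, charFun_apply, integral_smul_nnreal_measure, integral_smul_nnreal_measure]
  exact h

/-- Averages over the unit sphere of positively homogeneous functions are proportional to
Gaussian integrals. -/
theorem exists_sphere_average_eq_mul_integral_gaussianWeight (E : Type*) [NormedAddCommGroup E]
    [InnerProductSpace ℝ E] [MeasurableSpace E] [BorelSpace E] [FiniteDimensional ℝ E] (d : ℝ) :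
    ∃ C : ℝ, 0 ≤ C ∧ ∀ F : E → ℝ, Measurable F → (∀ c : ℝ, 0 ≤ c → ∀ x, F (c • x) = c * F x) →
      (∫ x in Metric.sphere 0 1, F x ∂μH[d]) / (μH[d] (Metric.sphere (0 : E) 1)).toReal
        = C * ∫ x, F x ∂gaussianWeight E := by
  by_cases h0 : (μH[d] (Metric.sphere (0 : E) 1)).toReal = 0
  · exact ⟨0, le_rfl, fun F _ _ => by simp [h0]⟩
  obtain ⟨hne, hlt⟩ : μH[d] (Metric.sphere (0 : E) 1) ≠ 0 ∧
      μH[d] (Metric.sphere (0 : E) 1) ≠ ∞ := by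
    constructor <;> intro h <;> simp [h] at h0
  have hfin : IsFiniteMeasure (μH[d].restrict (Metric.sphere (0 : E) 1)) :=
    ⟨by simpa using hlt.lt_top⟩
  obtain ⟨x₀, hx₀⟩ : (Metric.sphere (0 : E) 1).Nonempty := by
    by_contra h
    simp [Set.not_nonempty_iff_eq_empty.1 h] at hne
  have hx₀' : ‖x₀‖ = 1 := by simpa using hx₀
  have hnt : Nontrivial E := ⟨x₀, 0, fun h => by simp [h] at hx₀'⟩
  let γ := (gaussianWeight E).withDensity fun x => ENNReal.ofReal ‖x‖
  have hγ : IsFiniteMeasure γ := isFiniteMeasure_withDensity_ofReal integrable_norm_gaussianWeight.2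
  have hm : Measurable fun x : E => ‖x‖⁻¹ • x := by fun_prop
  let ν := γ.map fun x => ‖x‖⁻¹ • x
  have hγ_inv (R : E ≃ₗᵢ[ℝ] E) : MeasurePreserving R γ γ := by
    refine ⟨R.continuous.measurable, ?_⟩
    ext s hs
    rw [Measure.map_apply R.continuous.measurable hs,
      withDensity_apply _ (R.continuous.measurable hs), withDensity_apply _ hs,
      ← (measurePreserving_gaussianWeight R).setLIntegral_comp_preimage hs (by fun_prop)]
    simp
  have hν_inv (R : E ≃ₗᵢ[ℝ] E) : MeasurePreserving R ν ν := by
    refine ⟨R.continuous.measurable, ?_⟩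
    have e : (R ∘ fun x : E => ‖x‖⁻¹ • x) = (fun x => ‖x‖⁻¹ • x) ∘ R := by
      ext x
      simp
    rw [Measure.map_map R.continuous.measurable hm, e,
      ← Measure.map_map hm R.continuous.measurable, (hγ_inv R).map_eq]
  have hσ_inv (R : E ≃ₗᵢ[ℝ] E) : MeasurePreserving R (μH[d].restrict (Metric.sphere (0 : E) 1))
      (μH[d].restrict (Metric.sphere (0 : E) 1)) := by
    have h := (R.toIsometryEquiv.measurePreserving_hausdorffMeasure d).restrict_preimage
      (Metric.isClosed_sphere (x := (0 : E)) (ε := 1)).measurableSet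
    have e : R.toIsometryEquiv ⁻¹' Metric.sphere (0 : E) 1 = Metric.sphere 0 1 := by
      ext x
      simp only [Set.mem_preimage, mem_sphere_zero_iff_norm,
        LinearIsometryEquiv.coe_toIsometryEquiv, R.norm_map]
    rwa [e] at h
  have h0γ : ∀ᵐ x ∂gaussianWeight E, x ≠ 0 := by
    refine (withDensity_absolutelyContinuous _ _).ae_le ?_
    exact Measure.ae_ne volume 0
  have hν₁ : ∀ᵐ v ∂ν, ‖v‖ = 1 := by
    rw [ae_map_iff hm.aemeasurable (measurableSet_eq_fun (by fun_prop) (by fun_prop))]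
    filter_upwards [(withDensity_absolutelyContinuous _ _).ae_le h0γ] with x hx
    simp [norm_smul, hx]
  have hσ₁ : ∀ᵐ v ∂μH[d].restrict (Metric.sphere (0 : E) 1), ‖v‖ = 1 := by
    filter_upwards [ae_restrict_mem Metric.isClosed_sphere.measurableSet] with x hx
    simpa using hx
  have hνF (F : E → ℝ) (hF : Measurable F) (hh : ∀ c : ℝ, 0 ≤ c → ∀ x, F (c • x) = c * F x) :
      ∫ x, F x ∂ν = ∫ x, F x ∂gaussianWeight E := by
    rw [integral_map hm.aemeasurable hF.aestronglyMeasurable,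
      integral_withDensity_eq_integral_toReal_smul (by fun_prop) (by simp)]
    refine integral_congr_ae ?_
    filter_upwards [h0γ] with x hx
    rw [hh _ (by positivity)]
    simp [hx]
  have hν0 : ν.real Set.univ ≠ 0 := by
    intro h
    have h : ν Set.univ = 0 := by
      rwa [measureReal_def, ENNReal.toReal_eq_zero_iff, or_iff_left (measure_ne_top _ _)] at h
    rw [Measure.measure_univ_eq_zero, Measure.map_eq_zero_iff hm.aemeasurable] at h
    have h1 : ∀ᵐ x ∂gaussianWeight E, x = 0 := by
      have := (withDensity_eq_zero_iff (by fun_prop)).1 h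
      filter_upwards [this] with x hx
      simpa using hx
    have h2 : gaussianWeight E = 0 := by
      rw [← ae_eq_bot, ← Filter.eventually_false_iff_eq_bot]
      filter_upwards [h0γ, h1] with x hx hx'
      exact hx hx'
    have h3 : ∀ᵐ x : E, False := by
      filter_upwards [(withDensity_eq_zero_iff (by fun_prop)).1 h2] with x hx
      simp only [Pi.zero_apply, ENNReal.ofReal_eq_zero] at hx
      exact (Real.exp_pos _).not_ge hx
    rw [Filter.eventually_false_iff_eq_bot, ae_eq_bot] at h3
    exact NeZero.ne (volume : Measure E) h3
  refine ⟨(ν.real Set.univ)⁻¹, by positivity, fun F hF hh => ?_⟩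
  have h := congrArg (fun μ => ∫ x, F x ∂μ)
    (smul_eq_smul_of_measurePreserving hσ_inv hν_inv hσ₁ hν₁)
  simp only [integral_smul_nnreal_measure, hνF F hF hh, Measure.restrict_apply_univ] at h
  have h' : ν.real Set.univ * ∫ x in Metric.sphere 0 1, F x ∂μH[d]
      = (μH[d] (Metric.sphere (0 : E) 1)).toReal * ∫ x, F x ∂gaussianWeight E := h
  rw [div_eq_iff h0, inv_mul_eq_div, div_mul_eq_mul_div, eq_div_iff hν0]
  linarith

end InvariantMeasure

section SupportFunction

variable {n : ℕ}

theorem isGreatest_inner_image_lqBall_top (u : EuclideanSpace ℝ (Fin n)) :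
    IsGreatest ((fun x => ⟪x, u⟫) '' lqBall n ∞) ((∑ i, |u i| ^ (1 : ℝ)) ^ (1 / 1 : ℝ)) := by
  simp only [div_one, Real.rpow_one]
  refine ⟨⟨WithLp.toLp 2 fun i => SignType.sign (u i), ?_, ?_⟩, ?_⟩
  · simp only [lqBall, if_true, Set.mem_ofPred_eq]
    intro i
    rcases lt_trichotomy (u i) 0 with h | h | h <;> simp [h]
  · simp [PiLp.inner_apply, self_mul_sign]
  · rintro _ ⟨x, hx, rfl⟩
    simp only [lqBall, if_true, Set.mem_ofPred_eq] at hx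
    simp only [PiLp.inner_apply, Real.inner_apply]
    refine Finset.sum_le_sum fun i _ => (le_abs_self _).trans ?_
    rw [abs_mul]
    exact mul_le_of_le_one_left (abs_nonneg _) (hx i)

theorem isGreatest_inner_image_lqBall {p : ℝ} {q : ℝ≥0∞} (hq : q ≠ ∞)
    (hpq : p.HolderConjugate q.toReal) (u : EuclideanSpace ℝ (Fin n)) :
    IsGreatest ((fun x => ⟪x, u⟫) '' lqBall n q) ((∑ i, |u i| ^ p) ^ (1 / p)) := by
  constructor
  · obtain ⟨g, hg, hgu⟩ := (NNReal.isGreatest_Lp Finset.univ (fun i => ‖u i‖₊) hpq).1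
    refine ⟨WithLp.toLp 2 fun i => SignType.sign (u i) * g i, ?_, ?_⟩
    · simp only [lqBall, if_neg hq, Set.mem_ofPred_eq]
      have hg' : ∑ i, (g i : ℝ) ^ q.toReal ≤ 1 := mod_cast hg
      refine le_trans (Finset.sum_le_sum fun i _ => ?_) hg'
      refine Real.rpow_le_rpow (abs_nonneg _) ?_ hpq.symm.nonneg
      rw [abs_mul, NNReal.abs_eq]
      refine mul_le_of_le_one_left (g i).2 ?_
      rcases lt_trichotomy (u i) 0 with h | h | h <;> simp [h]
    · have h := congrArg ((↑) : NNReal → ℝ) hgu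
      simp only [NNReal.coe_sum, NNReal.coe_mul, NNReal.coe_rpow, coe_nnnorm,
        Real.norm_eq_abs] at h
      rw [← h]
      simp only [PiLp.inner_apply, Real.inner_apply]
      refine Finset.sum_congr rfl fun i _ => ?_
      rw [← self_mul_sign (u i)]
      ring
  · rintro _ ⟨x, hx, rfl⟩
    simp only [lqBall, if_neg hq, Set.mem_ofPred_eq] at hx
    simp only [PiLp.inner_apply, Real.inner_apply, mul_comm (x _)]
    refine (Real.inner_le_Lp_mul_Lq Finset.univ _ _ hpq).trans ?_
    refine mul_le_of_le_one_right (by positivity) (Real.rpow_le_one (by positivity) hx ?_)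
    exact one_div_nonneg.2 hpq.symm.nonneg

/-- For `2 < q ≤ ∞` the support function of `B_q^n` is an `ℓ_p` norm with `1 ≤ p ≤ 2`. -/
theorem exists_isGreatest_inner_image_lqBall (n : ℕ) {q : ℝ≥0∞} (hq : 2 < q) :
    ∃ p : ℝ, 1 ≤ p ∧ p ≤ 2 ∧ ∀ u : EuclideanSpace ℝ (Fin n),
      IsGreatest ((fun x => ⟪x, u⟫) '' lqBall n q) ((∑ i, |u i| ^ p) ^ (1 / p)) := by
  by_cases h : q = ∞
  · subst h
    exact ⟨1, le_rfl, one_le_two, isGreatest_inner_image_lqBall_top⟩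
  · have h2 : 2 < q.toReal := by
      simpa using (ENNReal.toReal_lt_toReal (by simp) h).2 hq
    have hc := (Real.HolderConjugate.conjExponent (one_lt_two.trans h2)).symm
    refine ⟨_, hc.lt.le, ?_, isGreatest_inner_image_lqBall h hc⟩
    rw [Real.conjExponent, div_le_iff₀ (by linarith)]
    linarith

end SupportFunction

section HyperplaneAverage

variable {m : ℕ} {L : EuclideanSpace ℝ (Fin m) →ₗᵢ[ℝ] EuclideanSpace ℝ (Fin (m + 1))}
  {a : EuclideanSpace ℝ (Fin (m + 1))}

theorem exists_linearIsometry_hyperplane (ha : ‖a‖ = 1) :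
    ∃ L : EuclideanSpace ℝ (Fin m) →ₗᵢ[ℝ] EuclideanSpace ℝ (Fin (m + 1)), ∀ x, ⟪L x, a⟫ = 0 := by
  have : Fact (Module.finrank ℝ (EuclideanSpace ℝ (Fin (m + 1))) = m + 1) := ⟨by simp⟩
  have ha0 : a ≠ 0 := fun h => by simp [h] at ha
  have hr : Module.finrank ℝ (Submodule.span ℝ {a})ᗮ = m :=
    Submodule.finrank_orthogonal_span_singleton ha0
  let b := (stdOrthonormalBasis ℝ (Submodule.span ℝ {a})ᗮ).reindex (finCongr hr)
  refine ⟨(Submodule.span ℝ {a})ᗮ.subtypeₗᵢ.comp b.repr.symm.toLinearIsometry, fun x => ?_⟩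
  exact Submodule.mem_orthogonal_singleton_iff_inner_left.1 (b.repr.symm x).2

theorem image_sphere_linearIsometry (ha : ‖a‖ = 1) (hL : ∀ x, ⟪L x, a⟫ = 0) :
    L '' Metric.sphere 0 1 = {u | ‖u‖ = 1 ∧ ⟪u, a⟫ = 0} := by
  obtain ⟨Φ, hΦ⟩ := exists_hyperplane_coordinates L ha hL (by simp)
  ext u
  constructor
  · rintro ⟨x, hx, rfl⟩
    exact ⟨by simpa using hx, hL x⟩
  · rintro ⟨hu, hua⟩
    obtain ⟨z, rfl⟩ := Φ.surjective u
    have hz : z.snd = 0 := by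
      simpa [hΦ, inner_add_left, inner_smul_left, hL, ha] using hua
    refine ⟨z.fst, ?_, by simp [hΦ, hz]⟩
    simpa [hΦ, hz] using hu

theorem sSup_inner_image_sub_smul {B : Set (EuclideanSpace ℝ (Fin (m + 1)))}
    {u : EuclideanSpace ℝ (Fin (m + 1))} {r : ℝ} (hB : IsGreatest ((fun x => ⟪x, u⟫) '' B) r)
    (hu : ⟪u, a⟫ = 0) :
    sSup ((fun x => ⟪x, u⟫) '' ((fun x => x - ⟪x, a⟫ • a) '' B)) = r := by
  rw [← hB.csSup_eq, Set.image_image]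
  simp [inner_sub_left, inner_smul_left, real_inner_comm u a, hu]

/-- Mean widths of hyperplane projections as Gaussian averages of the support function. -/
theorem exists_meanWidthProj_eq_mul_integral (m : ℕ) : ∃ C : ℝ, 0 ≤ C ∧
    ∀ (B : Set (EuclideanSpace ℝ (Fin (m + 2)))) (N : EuclideanSpace ℝ (Fin (m + 2)) → ℝ),
    Measurable N → (∀ c : ℝ, 0 ≤ c → ∀ u, N (c • u) = c * N u) →
    (∀ u, IsGreatest ((fun x => ⟪x, u⟫) '' B) (N u)) →
    ∀ (a : EuclideanSpace ℝ (Fin (m + 2)))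
      (L : EuclideanSpace ℝ (Fin (m + 1)) →ₗᵢ[ℝ] EuclideanSpace ℝ (Fin (m + 2))), ‖a‖ = 1 →
    (∀ x, ⟪L x, a⟫ = 0) →
    meanWidthProj (m + 2) B a = C * ∫ x, N (L x) ∂gaussianWeight _ := by
  obtain ⟨C, hC, h⟩ := exists_sphere_average_eq_mul_integral_gaussianWeight
    (EuclideanSpace ℝ (Fin (m + 1))) (((m + 2 : ℕ) : ℝ) - 2)
  have hd : (0 : ℝ) ≤ ((m + 2 : ℕ) : ℝ) - 2 := by push_cast; linarith [m.cast_nonneg (α := ℝ)]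
  refine ⟨C, hC, fun B N hN hh hB a L ha hL => ?_⟩
  rw [← h (fun x => N (L x)) (hN.comp L.continuous.measurable) fun c hc x => by
      simp [hh c hc], meanWidthProj, ← image_sphere_linearIsometry ha hL,
    L.isometry.hausdorffMeasure_image (.inl hd)]
  congr 1
  have hS : MeasurableSet (L '' Metric.sphere 0 1) :=
    ((isCompact_sphere _ _).image L.continuous).measurableSet
  rw [setIntegral_congr_fun (g := N) hS]
  · have hr : L '' Metric.sphere 0 1 ⊆ Set.range L := Set.image_subset_range _ _
    have he := L.isometry.isClosedEmbedding.measurableEmbedding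
    rw [← Set.inter_eq_left.2 hr, ← Measure.restrict_restrict hS,
      ← L.isometry.map_hausdorffMeasure (.inl hd), he.setIntegral_map,
      Set.preimage_image_eq _ L.injective]
  · intro u hu
    rw [image_sphere_linearIsometry ha hL] at hu
    exact sSup_inner_image_sub_smul (hB u) hu.2

end HyperplaneAverage

section Comparison

variable {ι : Type*} [Fintype ι]

theorem sum_abs_rpow_rpow_le {p : ℝ} (hp : 0 < p) (u : EuclideanSpace ℝ ι) :
    (∑ i, |u i| ^ p) ^ (1 / p) ≤ (Fintype.card ι : ℝ) ^ (1 / p) * ‖u‖ := by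
  have h : ∑ i, |u i| ^ p ≤ Fintype.card ι * ‖u‖ ^ p := by
    rw [← nsmul_eq_mul]
    exact Finset.sum_le_card_nsmul _ _ _ fun i _ =>
      Real.rpow_le_rpow (abs_nonneg _) (PiLp.norm_apply_le u i) hp.le
  refine (Real.rpow_le_rpow (by positivity) h (by positivity)).trans_eq ?_
  rw [Real.mul_rpow (by positivity) (by positivity), ← Real.rpow_mul (norm_nonneg _),
    mul_one_div_cancel hp.ne', Real.rpow_one]

theorem sum_abs_smul_rpow_rpow {p : ℝ} (hp : 0 < p) {c : ℝ} (hc : 0 ≤ c)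
    (u : EuclideanSpace ℝ ι) :
    (∑ i, |(c • u) i| ^ p) ^ (1 / p) = c * (∑ i, |u i| ^ p) ^ (1 / p) := by
  simp_rw [PiLp.smul_apply, smul_eq_mul, abs_mul, abs_of_nonneg hc,
    Real.mul_rpow hc (abs_nonneg _), ← Finset.mul_sum]
  rw [Real.mul_rpow (by positivity) (by positivity), ← Real.rpow_mul hc,
    mul_one_div_cancel hp.ne', Real.rpow_one]

theorem meanWidthProj_one (B : Set (EuclideanSpace ℝ (Fin 1))) {a : EuclideanSpace ℝ (Fin 1)}
    (ha : ‖a‖ = 1) : meanWidthProj 1 B a = 0 := by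
  have h : {u : EuclideanSpace ℝ (Fin 1) | ‖u‖ = 1 ∧ ⟪u, a⟫ = 0} = ∅ := by
    ext u
    simp only [Set.mem_ofPred_eq, Set.mem_empty_iff_false, iff_false, not_and]
    intro hu h0
    have hu2 := EuclideanSpace.real_norm_sq_eq u
    have ha2 := EuclideanSpace.real_norm_sq_eq a
    simp only [hu, ha, Fin.sum_univ_one, PiLp.inner_apply, Real.inner_apply] at hu2 ha2 h0
    rcases mul_eq_zero.1 h0 with h | h <;> simp_all
  rw [meanWidthProj, h]
  simp

/-- If the squared coordinates of `a` are an average of coordinate permutations of those of `c`,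
then the projection of `B_q^n` to `a^⊥` has the larger mean width. -/
theorem meanWidthProj_lqBall_le {κ : Type*} [Fintype κ] {n : ℕ} {q : ℝ≥0∞} (hq : 2 < q)
    {a c : EuclideanSpace ℝ (Fin n)} (ha : ‖a‖ = 1) (hc : ‖c‖ = 1)
    {w : κ → ℝ} (hw : ∀ k, 0 ≤ w k) (hw₁ : ∑ k, w k = 1) (σ : κ → Equiv.Perm (Fin n))
    (hac : ∀ i, a i ^ 2 = ∑ k, w k * c (σ k i) ^ 2) :
    meanWidthProj n (lqBall n q) c ≤ meanWidthProj n (lqBall n q) a := by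
  match n with
  | 0 => simp [Subsingleton.elim a 0] at ha
  | 1 => rw [meanWidthProj_one _ ha, meanWidthProj_one _ hc]
  | m + 2 =>
    obtain ⟨p, hp₁, hp₂, hp⟩ := exists_isGreatest_inner_image_lqBall (m + 2) hq
    have hp₀ : 0 < p := by linarith
    obtain ⟨C, hC, hmw⟩ := exists_meanWidthProj_eq_mul_integral m
    obtain ⟨L, hL⟩ := exists_linearIsometry_hyperplane ha
    obtain ⟨M, hM⟩ := exists_linearIsometry_hyperplane hc
    have hmeas : Measurable fun u : EuclideanSpace ℝ (Fin (m + 2)) =>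
        (∑ i, |u i| ^ p) ^ (1 / p) := by fun_prop
    have hmw' := hmw (lqBall (m + 2) q) _ hmeas (fun c hc u => sum_abs_smul_rpow_rpow hp₀ hc u) hp
    rw [hmw' c M hc hM, hmw' a L ha hL]
    refine mul_le_mul_of_nonneg_left ?_ hC
    let R (k) : EuclideanSpace ℝ (Fin (m + 2)) ≃ₗᵢ[ℝ] EuclideanSpace ℝ (Fin (m + 2)) :=
      LinearIsometryEquiv.piLpCongrLeft 2 ℝ ℝ (σ k).symm
    have hR (k u i) : R k u i = u (σ k i) := rfl
    have h := (IsGaussianExponent.lpNorm hp₁ hp₂).sum_le_integral_comp (by simp) ha hL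
      (b := fun k => R k c) (M := fun k => (R k).toLinearIsometry.comp M)
      (fun k => by simp [hc]) (fun k x => by simp [hM]) hw hw₁ hac
      (fun u => by positivity) hmeas (fun u => sum_abs_rpow_rpow_le hp₀ u)
    have hN (k x) : ∑ i, |((R k).toLinearIsometry.comp M) x i| ^ p = ∑ i, |M x i| ^ p :=
      Equiv.sum_comp (σ k) fun i => |M x i| ^ p
    simpa only [hN, ← Finset.sum_mul, hw₁, one_mul] using h

end Comparison

/-- **Corollary 17 (extremal mean widths of hyperplane projections of `B_q^n`, `q ∈ (2,∞]`).** -/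
theorem meanWidth_projections_lq_ball {n : ℕ} (hn : 1 ≤ n) (q : ℝ≥0∞) (hq : 2 < q)
    (a : EuclideanSpace ℝ (Fin n)) (ha : ‖a‖ = 1)
    (e₁ : EuclideanSpace ℝ (Fin n)) (he₁ : ∀ i, e₁ i = if (i : ℕ) = 0 then 1 else 0)
    (d : EuclideanSpace ℝ (Fin n)) (hd : ∀ i, d i = (Real.sqrt n)⁻¹) :
    meanWidthProj n (lqBall n q) e₁ ≤ meanWidthProj n (lqBall n q) a ∧
      meanWidthProj n (lqBall n q) a ≤ meanWidthProj n (lqBall n q) d := by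
  have : NeZero n := ⟨by omega⟩
  have hn0 : (n : ℝ) ≠ 0 := Nat.cast_ne_zero.2 (NeZero.ne n)
  have hsq : ∑ i, a i ^ 2 = 1 := by rw [← EuclideanSpace.real_norm_sq_eq, ha, one_pow]
  have he (i : Fin n) : e₁ i = if i = 0 then 1 else 0 :=
    (he₁ i).trans (if_congr Fin.val_eq_zero_iff rfl rfl)
  have hd2 (i) : d i ^ 2 = (n : ℝ)⁻¹ := by simp [hd]
  have hne : ‖e₁‖ = 1 := by
    rw [← sq_eq_sq₀ (norm_nonneg _) zero_le_one, EuclideanSpace.real_norm_sq_eq]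
    simp [he]
  have hnd : ‖d‖ = 1 := by
    rw [← sq_eq_sq₀ (norm_nonneg _) zero_le_one, EuclideanSpace.real_norm_sq_eq]
    simp [hd2, hn0]
  constructor
  · refine meanWidthProj_lqBall_le hq ha hne (fun k => sq_nonneg (a k)) hsq
      (fun k => Equiv.swap 0 k) fun i => ?_
    have h (k) : e₁ (Equiv.swap 0 k i) ^ 2 = if i = k then 1 else 0 := by
      simp [he, Equiv.swap_apply_eq_iff]
    simp [h]
  · refine meanWidthProj_lqBall_le hq hnd ha (w := fun _ : Fin n => (n : ℝ)⁻¹)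
      (fun _ => by positivity) (by simp [hn0]) (fun k => Equiv.addRight k) fun i => ?_
    rw [← Finset.mul_sum, hd2]
    have h := Equiv.sum_comp (Equiv.addLeft i) fun j => a j ^ 2
    simp only [Equiv.coe_addLeft] at h
    simp [h, hsq]
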